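/- Let h ∈ S(ℝ²;ℂ), and define u(x,y) = (1/(2π)) ∫_{ℝ²} (−2i/(ξ₁ + iξ₂)) F(h)(ξ₁,ξ₂) e^{i(ξ₁x + ξ₂y)} dξ₁ dξ₂. Then u possesses a complete asymptotic expansion in powers of 1/z as |z| → ∞: for every N ≥ 1 there exist c₁, …, c_N ∈ ℂ such that u(x,y) − Σ_{j=1}^{N} c_j z^{−j} = O(|z|^{−(N+1)}) as |z| → ∞, where z = x + iy. -/

import Mathlib

open Complex MeasureTheory Filter Bornology Asymptotics

/-- The Fourier transform on ℝ² ≅ ℂ, with the symmetric 1/(2π) normalization. -/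
noncomputable def fourierT (f : ℂ → ℂ) (ξ : ℂ) : ℂ :=
  (1 / (2 * Real.pi)) *
    ∫ z : ℂ, f z * Complex.exp (-Complex.I * Complex.ofReal (ξ.re * z.re + ξ.im * z.im))

open Set Topology in
lemma cauchyPompeiu_aux (f : ℂ → ℂ) (f' : ℂ → ℂ →L[ℝ] ℂ) (hf : ∀ x, HasFDerivAt f (f' x) x)
    (hc : Continuous f') (C : ℝ) (hb : ∀ x, ‖f' x‖ ≤ C * (1 + ‖x‖ ^ 2)⁻¹)
    (h0 : Tendsto f (cobounded ℂ) (𝓝 0)) :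
    ∫ ξ : ℂ, (f' ξ 1 + I * f' ξ I) / ξ = -(2 * Real.pi) * f 0 := by
  let e : ℝ → ℂ := fun θ => Real.cos θ + Real.sin θ * I
  have he : ∀ θ, ‖e θ‖ = 1 := by
    intro θ
    have : e θ = exp (θ * I) := by simp [e, exp_mul_I]
    rw [this, norm_exp_ofReal_mul_I]
  have hec : Continuous e := by fun_prop
  let A : ℝ × ℝ → ℂ := fun p => f' (p.1 * e p.2) (e p.2)
  let B : ℝ × ℝ → ℂ := fun p => f' (p.1 * e p.2) (I * e p.2)
  have hAc : Continuous A := by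
    refine (hc.comp (by fun_prop)).clm_apply (by fun_prop)
  have hBc : Continuous B := by
    refine (hc.comp (by fun_prop)).clm_apply (by fun_prop)
  have hCr : ∀ r θ : ℝ, ‖f' (r * e θ)‖ ≤ C * (1 + r ^ 2)⁻¹ := by
    intro r θ
    have := hb (r * e θ)
    rwa [norm_mul, he, mul_one, norm_real, Real.norm_eq_abs, sq_abs] at this
  have hAb : ∀ r θ : ℝ, ‖A (r, θ)‖ ≤ C * (1 + r ^ 2)⁻¹ := by
    intro r θ
    refine ((f' _).le_opNorm _).trans ?_
    simpa [he] using hCr r θ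
  have hBb : ∀ r θ : ℝ, ‖B (r, θ)‖ ≤ C * (1 + r ^ 2)⁻¹ := by
    intro r θ
    refine ((f' _).le_opNorm _).trans ?_
    simpa [he] using hCr r θ
  have hdom : Integrable (fun p : ℝ × ℝ => C * (1 + p.1 ^ 2)⁻¹ * 1)
      ((volume.restrict (Ioi (0:ℝ))).prod (volume.restrict (Ioo (-Real.pi) Real.pi))) := by
    have h1 : Integrable (fun r : ℝ => C * (1 + r ^ 2)⁻¹) (volume.restrict (Ioi (0:ℝ))) :=
      (integrable_inv_one_add_sq.const_mul C).restrict
    exact h1.mul_prod (integrable_const (1:ℝ))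
  have hAi : Integrable A
      ((volume.restrict (Ioi (0:ℝ))).prod (volume.restrict (Ioo (-Real.pi) Real.pi))) :=
    hdom.mono' hAc.aestronglyMeasurable (.of_forall fun p => by simpa using hAb p.1 p.2)
  have hBi : Integrable B
      ((volume.restrict (Ioi (0:ℝ))).prod (volume.restrict (Ioo (-Real.pi) Real.pi))) :=
    hdom.mono' hBc.aestronglyMeasurable (.of_forall fun p => by simpa using hBb p.1 p.2)
  have hAint : ∀ θ : ℝ, ∫ r in Ioi (0:ℝ), A (r, θ) = - f 0 := by
    intro θ
    have hd : ∀ r : ℝ, HasDerivAt (fun r : ℝ => f (r * e θ)) (A (r, θ)) r := by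
      intro r
      have h1 : HasDerivAt (fun r : ℝ => (r : ℂ) * e θ) (e θ) r := by
        simpa using (ofRealCLM.hasDerivAt (x := r)).mul_const (e θ)
      exact (hf (r * e θ)).comp_hasDerivAt r h1
    have := integral_Ioi_of_hasDerivAt_of_tendsto' (a := 0) (f := fun r : ℝ => f (r * e θ))
      (f' := fun r => A (r, θ)) (m := 0) (fun r _ => hd r) ?_ ?_
    · rw [this]; simp
    · refine Integrable.mono' ((integrable_inv_one_add_sq.const_mul C).restrict)
        (Continuous.aestronglyMeasurable (by fun_prop)) (.of_forall fun r => hAb r θ)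
    · refine h0.comp ?_
      rw [← tendsto_norm_atTop_iff_cobounded]
      simpa [he] using tendsto_abs_atTop_atTop
  have hBint : ∀ r ∈ Ioi (0:ℝ), ∫ θ in Ioo (-Real.pi) Real.pi, B (r, θ) = 0 := by
    intro r hr
    have hr' : (r:ℂ) ≠ 0 := by exact_mod_cast (ne_of_gt hr)
    have hd : ∀ θ : ℝ, HasDerivAt (fun θ : ℝ => (r:ℂ)⁻¹ * f (r * e θ)) (B (r, θ)) θ := by
      intro θ
      have h1 : HasDerivAt (fun θ : ℝ => (r : ℂ) * e θ) (r * (I * e θ)) θ := by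
        have h2 : HasDerivAt e (I * e θ) θ := by
          have := (Real.hasDerivAt_cos θ).ofReal_comp.add
            ((Real.hasDerivAt_sin θ).ofReal_comp.mul_const I)
          refine this.congr_deriv ?_
          simp only [e]
          push_cast
          linear_combination (-Complex.sin θ) * I_sq
        exact h2.const_mul _
      have h3 := ((hf (r * e θ)).comp_hasDerivAt θ h1).const_mul (r:ℂ)⁻¹
      refine h3.congr_deriv ?_
      have : (r:ℂ) * (I * e θ) = r • (I * e θ) := by simp
      rw [this, map_smul, real_smul, inv_mul_cancel_left₀ hr']
    rw [← integral_Ioc_eq_integral_Ioo, ← intervalIntegral.integral_of_le (by linarith [Real.pi_pos]),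
      intervalIntegral.integral_eq_sub_of_hasDerivAt (fun θ _ => hd θ)
        (Continuous.intervalIntegrable (by fun_prop) _ _)]
    simp [e]
  rw [← Complex.integral_comp_polarCoord_symm, polarCoord_target]
  have hcongr : ∫ p in Ioi (0:ℝ) ×ˢ Ioo (-Real.pi) Real.pi,
      p.1 • ((f' (Complex.polarCoord.symm p) 1 + I * f' (Complex.polarCoord.symm p) I) /
        Complex.polarCoord.symm p) =
      ∫ p in Ioi (0:ℝ) ×ˢ Ioo (-Real.pi) Real.pi, (A p + I * B p) := by
    refine setIntegral_congr_fun (measurableSet_Ioi.prod measurableSet_Ioo) fun p hp => ?_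
    have hr' : (p.1:ℂ) ≠ 0 := by exact_mod_cast (ne_of_gt hp.1)
    have hs : Complex.polarCoord.symm p = p.1 * e p.2 := by
      rw [Complex.polarCoord_symm_apply]
    have hen : e p.2 ≠ 0 := by
      intro h; have := he p.2; simp [h] at this
    simp only [hs, A, B]
    set T := f' (p.1 * e p.2)
    have t1 : T (e p.2) = Real.cos p.2 * T 1 + Real.sin p.2 * T I := by
      have : e p.2 = Real.cos p.2 • (1:ℂ) + Real.sin p.2 • I := by simp [e]
      rw [this, map_add, map_smul, map_smul, real_smul, real_smul]
    have t2 : T (I * e p.2) = -Real.sin p.2 * T 1 + Real.cos p.2 * T I := by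
      have : I * e p.2 = (-Real.sin p.2) • (1:ℂ) + Real.cos p.2 • I := by
        simp [e]; linear_combination (Complex.sin p.2) * I_sq
      rw [this, map_add, map_smul, map_smul, real_smul, real_smul]; push_cast; rfl
    rw [t1, t2, real_smul]
    have hcs : (Real.cos p.2 : ℂ) ^ 2 + (Real.sin p.2 : ℂ) ^ 2 = 1 := by
      exact_mod_cast Real.cos_sq_add_sin_sq p.2
    field_simp
    simp only [e]
    linear_combination (-(T 1 + I * T I)) * hcs + (T 1 * (Real.sin p.2 : ℂ) ^ 2 - Real.cos p.2 * Real.sin p.2 * T I + 0) * I_sq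
  rw [hcongr, Measure.volume_eq_prod, ← Measure.prod_restrict,
    integral_add hAi (hBi.const_mul I), integral_const_mul, integral_prod_symm _ hAi,
    integral_prod _ hBi, setIntegral_congr_fun measurableSet_Ioi hBint]
  simp only [hAint]
  simp [Real.pi_pos.le]
  left; ring

lemma integrable_kernel_aux : Integrable (fun ξ : ℂ => ‖ξ‖⁻¹ * (1 + ‖ξ‖ ^ 2)⁻¹) := by
  have := (integrable_fun_norm_addHaar (volume : Measure ℂ)
    (f := fun y : ℝ => y⁻¹ * (1 + y ^ 2)⁻¹)).2 ?_
  · exact this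
  · refine (integrable_inv_one_add_sq.integrableOn).congr_fun ?_ measurableSet_Ioi
    intro y hy
    have : y ≠ 0 := ne_of_gt hy
    simp [Complex.finrank_real_complex, this]

lemma schwartz_bd_aux {F : Type*} [NormedAddCommGroup F] [NormedSpace ℝ F]
    (g : SchwartzMap ℂ F) : ∃ C : ℝ, ∀ x, ‖g x‖ ≤ C * (1 + ‖x‖ ^ 2)⁻¹ := by
  obtain ⟨C0, _, h0⟩ := g.decay 0 0
  obtain ⟨C2, _, h2⟩ := g.decay 2 0
  refine ⟨C0 + C2, fun x => ?_⟩
  have a := h0 x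
  have b := h2 x
  rw [norm_iteratedFDeriv_zero] at a b
  rw [← div_eq_mul_inv, le_div_iff₀ (by positivity)]
  linarith

/-- the phase -/
noncomputable def phaseE (z ξ : ℂ) : ℂ :=
  Complex.exp (Complex.I * Complex.ofReal (ξ.re * z.re + ξ.im * z.im))

lemma norm_phaseE (z ξ : ℂ) : ‖phaseE z ξ‖ = 1 := by
  rw [phaseE, mul_comm, norm_exp_ofReal_mul_I]

@[fun_prop]
lemma continuous_phaseE (z : ℂ) : Continuous (phaseE z) := by
  unfold phaseE; fun_prop

/-- the linear functional -/
noncomputable def linL (z : ℂ) : ℂ →L[ℝ] ℂ := ofRealCLM.comp (z.re • reCLM + z.im • imCLM)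

lemma hasFDerivAt_phaseE (z ξ : ℂ) :
    HasFDerivAt (phaseE z) ((phaseE z ξ * I) • linL z) ξ := by
  have h1 : HasFDerivAt (fun ξ : ℂ => I * linL z ξ) (I • linL z) ξ :=
    (linL z).hasFDerivAt.const_mul I
  have h2 := h1.cexp
  have h3 : (fun ξ => cexp (I * linL z ξ)) = phaseE z := by
    ext ξ; simp [phaseE, linL, mul_comm]
  rw [h3] at h2
  have h4 : cexp (I * linL z ξ) = phaseE z ξ := congrFun h3 ξ
  rw [h4, smul_smul] at h2
  exact h2

/-- the integral transform -/
noncomputable def bigU (g : SchwartzMap ℂ ℂ) (z : ℂ) : ℂ := ∫ ξ : ℂ, g ξ / ξ * phaseE z ξ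

open LineDeriv in
/-- twice the dbar derivative -/
noncomputable def dbar2 (g : SchwartzMap ℂ ℂ) : SchwartzMap ℂ ℂ :=
  ∂_{(1:ℂ)} g + I • ∂_{I} g

lemma dbar2_apply (g : SchwartzMap ℂ ℂ) (ξ : ℂ) :
    dbar2 g ξ = fderiv ℝ g ξ 1 + I * fderiv ℝ g ξ I := by
  simp [dbar2, SchwartzMap.lineDerivOp_apply_eq_fderiv]

lemma integrable_bigU (g : SchwartzMap ℂ ℂ) (z : ℂ) :
    Integrable (fun ξ : ℂ => g ξ / ξ * phaseE z ξ) := by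
  obtain ⟨C, hC⟩ := schwartz_bd_aux g
  refine (integrable_kernel_aux.const_mul C).mono' ?_ (.of_forall fun ξ => ?_)
  · exact ((g.continuous.measurable.div measurable_id).mul
      (continuous_phaseE z).measurable).aestronglyMeasurable
  · rw [norm_mul, norm_phaseE, mul_one, norm_div, div_eq_mul_inv, mul_left_comm, mul_comm]
    exact mul_le_mul_of_nonneg_left (hC ξ) (by positivity)

lemma bigU_bounded (g : SchwartzMap ℂ ℂ) : ∃ M : ℝ, ∀ z, ‖bigU g z‖ ≤ M := by
  refine ⟨∫ ξ : ℂ, ‖g ξ / ξ‖, fun z => (norm_integral_le_integral_norm _).trans_eq ?_⟩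
  simp [norm_phaseE]

lemma bigU_step (g : SchwartzMap ℂ ℂ) (z : ℂ) :
    z * bigU g z = 2 * Real.pi * I * g 0 + I * bigU (dbar2 g) z := by
  obtain ⟨C, hC⟩ := schwartz_bd_aux g
  obtain ⟨C', hC'⟩ := schwartz_bd_aux (SchwartzMap.fderivCLM ℝ ℂ ℂ g)
  have hfd : ∀ ξ, SchwartzMap.fderivCLM ℝ ℂ ℂ g ξ = fderiv ℝ g ξ := fun ξ => rfl
  have key := cauchyPompeiu_aux (fun ξ => g ξ * phaseE z ξ)
    (fun ξ => g ξ • ((phaseE z ξ * I) • linL z) + phaseE z ξ • fderiv ℝ g ξ)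
    (fun ξ => (g.differentiableAt.hasFDerivAt).mul (hasFDerivAt_phaseE z ξ)) ?_
    (C * ‖linL z‖ + C') ?_ ?_
  · have hsplit : ∀ ξ : ℂ, ((g ξ • ((phaseE z ξ * I) • linL z) + phaseE z ξ • fderiv ℝ g ξ) 1 +
        I * (g ξ • ((phaseE z ξ * I) • linL z) + phaseE z ξ • fderiv ℝ g ξ) I) / ξ =
        (I * z) * (g ξ / ξ * phaseE z ξ) + dbar2 g ξ / ξ * phaseE z ξ := by
      intro ξ
      rw [dbar2_apply]
      have hz : linL z 1 + I * linL z I = z := by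
        simp [linL, mul_comm I]
      simp only [ContinuousLinearMap.add_apply, ContinuousLinearMap.smul_apply, smul_eq_mul]
      linear_combination (g ξ * phaseE z ξ * I / ξ) * hz
    simp only [hsplit] at key
    rw [integral_add ((integrable_bigU g z).const_mul _) (integrable_bigU _ z),
      integral_const_mul] at key
    have hp : phaseE z 0 = 1 := by simp [phaseE]
    rw [hp] at key
    change I * z * bigU g z + bigU (dbar2 g) z = _ at key
    linear_combination (-I) * key + z * bigU g z * I_sq
  · have h1 : Continuous (fun ξ => fderiv ℝ g ξ) := (SchwartzMap.fderivCLM ℝ ℂ ℂ g).continuous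
    have h2 := g.continuous
    fun_prop
  · intro ξ
    refine (norm_add_le _ _).trans ?_
    simp only [norm_smul, norm_mul, norm_phaseE, norm_I, one_mul]
    have a := hC ξ
    have b := hC' ξ
    rw [hfd] at b
    nlinarith [mul_le_mul_of_nonneg_right a (norm_nonneg (linL z))]
  · rw [tendsto_zero_iff_norm_tendsto_zero]
    simp only [norm_mul, norm_phaseE, mul_one]
    have := (zero_at_infty g).norm
    rw [norm_zero] at this
    rwa [Metric.cobounded_eq_cocompact]

lemma bigU_expansion (N : ℕ) : ∀ g : SchwartzMap ℂ ℂ, ∃ c : Fin N → ℂ,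
    (fun z : ℂ => bigU g z - ∑ j : Fin N, c j * z ^ (-(j : ℤ) - 1))
      =O[cobounded ℂ] fun z : ℂ => ‖z‖ ^ (-(N : ℤ) - 1) := by
  have hne : ∀ᶠ z : ℂ in cobounded ℂ, z ≠ 0 := eventually_ne_cobounded 0
  induction N with
  | zero =>
    intro g
    obtain ⟨M, hM⟩ := bigU_bounded (dbar2 g)
    refine ⟨Fin.elim0, IsBigO.of_bound (‖2 * Real.pi * I * g 0‖ + M) ?_⟩
    filter_upwards [hne] with z hz
    have hz' : 0 < ‖z‖ := norm_pos_iff.2 hz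
    have h1 := congrArg norm (bigU_step g z)
    have h2 : ‖2 * Real.pi * I * g 0 + I * bigU (dbar2 g) z‖ ≤ ‖2 * Real.pi * I * g 0‖ + M := by
      refine (norm_add_le _ _).trans ?_
      rw [norm_mul I, norm_I, one_mul]
      linarith [hM z]
    rw [← h1, norm_mul] at h2
    simp only [Finset.univ_eq_empty, Finset.sum_empty, sub_zero, Nat.cast_zero, neg_zero, zero_sub,
      zpow_neg_one, norm_inv, norm_norm]
    rw [← div_eq_mul_inv, le_div_iff₀ hz', mul_comm]
    exact h2
  | succ N ih =>
    intro g
    obtain ⟨c, hc⟩ := ih (dbar2 g)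
    refine ⟨Fin.cons (2 * Real.pi * I * g 0) (fun j => I * c j), ?_⟩
    have h1 : (fun z : ℂ => I * z⁻¹) =O[cobounded ℂ] fun z : ℂ => ‖z‖⁻¹ :=
      IsBigO.of_bound 1 (.of_forall fun z => by simp)
    refine (h1.mul hc).congr' ?_ ?_
    · filter_upwards [hne] with z hz
      rw [Fin.sum_univ_succ]
      have h2 : bigU g z = z⁻¹ * (2 * Real.pi * I * g 0 + I * bigU (dbar2 g) z) := by
        rw [← bigU_step, inv_mul_cancel_left₀ hz]
      have h3 : ∀ j : Fin N, z ^ (-((j.succ : Fin (N+1)) : ℤ) - 1) = z⁻¹ * z ^ (-(j:ℤ) - 1) := by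
        intro j
        rw [← zpow_neg_one, ← zpow_add₀ hz]
        congr 1; simp; ring
      simp only [Fin.cons_zero, Fin.cons_succ, h3]
      rw [h2, mul_sub, Finset.mul_sum]
      have h4 : ∑ i : Fin N, I * z⁻¹ * (c i * z ^ (-(i:ℤ) - 1)) =
          ∑ i : Fin N, I * c i * (z⁻¹ * z ^ (-(i:ℤ) - 1)) :=
        Finset.sum_congr rfl fun i _ => by ring
      rw [h4]
      simp
      ring
    · filter_upwards [hne] with z hz
      have hz' : ‖z‖ ≠ 0 := norm_ne_zero_iff.2 hz
      rw [← zpow_neg_one, ← zpow_add₀ hz']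
      congr 1; push_cast; ring

open FourierTransform in
lemma fourierT_schwartz (h : SchwartzMap ℂ ℂ) :
    ∃ g : SchwartzMap ℂ ℂ, ∀ ξ, g ξ = fourierT (fun w => h w) ξ := by
  have hpi : (2 * Real.pi)⁻¹ ≠ 0 := by positivity
  let L : ℂ ≃L[ℝ] ℂ := ContinuousLinearEquiv.smulLeft (Units.mk0 _ hpi)
  refine ⟨((1 / (2 * Real.pi) : ℂ)) • SchwartzMap.compCLMOfContinuousLinearEquiv ℝ L (𝓕 h), ?_⟩
  intro ξ
  have hL : L ξ = ((2 * Real.pi)⁻¹ : ℝ) • ξ := rfl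
  simp only [SchwartzMap.smul_apply, SchwartzMap.compCLMOfContinuousLinearEquiv_apply,
    Function.comp, smul_eq_mul, fourierT, hL]
  rw [SchwartzMap.fourier_coe, Real.fourier_eq']
  congr 1
  refine integral_congr_ae (.of_forall fun w => ?_)
  simp only [smul_eq_mul]
  rw [mul_comm]
  congr 2
  rw [real_inner_smul_right, Complex.inner]
  have : (Real.pi : ℂ) ≠ 0 := by exact_mod_cast Real.pi_ne_zero
  simp
  field_simp

/-- For h Schwartz, u = F⁻¹((−2i/ξ) F(h)) possesses a complete asymptotic expansion in
powers of 1/z as |z| → ∞: for every N ≥ 1 there are c₁, …, c_N ∈ ℂ with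
u(z) − Σ_{j=1}^{N} c_j z^{−j} = O(|z|^{−(N+1)}). -/
theorem stmt8 (h : SchwartzMap ℂ ℂ) :
    ∀ N : ℕ, 1 ≤ N → ∃ c : Fin N → ℂ,
      (fun z : ℂ =>
          ((1 / (2 * Real.pi)) *
            ∫ ξ : ℂ, (-2 * Complex.I / ξ) * fourierT (fun w => h w) ξ *
              Complex.exp (Complex.I * Complex.ofReal (ξ.re * z.re + ξ.im * z.im))) -
          ∑ j : Fin N, c j * z ^ (-(j : ℤ) - 1))
        =O[cobounded ℂ] fun z : ℂ => ‖z‖ ^ (-(N : ℤ) - 1) := by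
  intro N _
  obtain ⟨g, hg⟩ := fourierT_schwartz h
  obtain ⟨c, hc⟩ := bigU_expansion N (((1 / (2 * Real.pi) : ℂ) * (-2 * I)) • g)
  refine ⟨c, hc.congr_left fun z => ?_⟩
  congr 1
  rw [bigU, ← integral_const_mul]
  refine integral_congr_ae (.of_forall fun ξ => ?_)
  simp only [SchwartzMap.smul_apply, smul_eq_mul, hg, phaseE]
  ring
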